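/- Let k ≥ 1, m ≥ 1, and n₁, …, n_k ≥ 1 be integers, and let w = b⁻¹·a^{n₁}·b⁻¹·a^{n₂}·⋯·b⁻¹·a^{n_k}·b⁻¹·a·b·a^{−m}·b·a ∈ F₂. If n_i < m − 1 for some i ∈ {1, …, k}, then w is not potentially positive. -/

import Mathlib

abbrev F2 := FreeGroup (Fin 2)

def Positive2 (w : F2) : Prop :=
  w ∈ Submonoid.closure (Set.range (FreeGroup.of : Fin 2 → F2))

def PotPos2 (w : F2) : Prop := ∃ φ : F2 ≃* F2, Positive2 (φ w)

/-- The generators `a` and `b` of `F₂`. -/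
def ga : F2 := FreeGroup.of 0
def gb : F2 := FreeGroup.of 1

namespace Pump

open FreeGroup

theorem _root_.FreeGroup.IsReduced.part {l l' : List (Fin 2 × Bool)} (h : FreeGroup.IsReduced l')
    (hl : ∃ s t, s ++ l ++ t = l') : FreeGroup.IsReduced l := by
  obtain ⟨s, t, rfl⟩ := hl
  unfold FreeGroup.IsReduced at *
  rw [List.append_assoc, List.isChain_append, List.isChain_append] at h
  exact h.2.1.1

theorem red_decomp (l1 : List (Fin 2 × Bool)) : ∀ l2 : List (Fin 2 × Bool), FreeGroup.IsReduced l1 → FreeGroup.IsReduced l2 →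
    ∃ p x' y', l1 = x' ++ invRev p ∧ l2 = p ++ y' ∧ FreeGroup.IsReduced (x' ++ y') := by
  induction l1 using List.reverseRecOn with
  | nil => intro l2 _ h2; exact ⟨[], [], l2, by simp, by simp, by simpa using h2⟩
  | append_singleton l c ih =>
    intro l2 h1 h2
    cases l2 with
    | nil => exact ⟨[], l ++ [c], [], by simp, by simp, by simpa using h1⟩
    | cons d l2 =>
      by_cases hcd : c.1 = d.1 → c.2 = d.2
      · refine ⟨[], l ++ [c], d :: l2, by simp, by simp, ?_⟩
        unfold FreeGroup.IsReduced at *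
        rw [List.isChain_append]
        refine ⟨h1, h2, ?_⟩
        simpa using hcd
      · push Not at hcd
        obtain ⟨p, x', y', e1, e2, e3⟩ := ih l2 (h1.part ⟨[], [c], by simp⟩) (h2.part ⟨[d], [], by simp⟩)
        refine ⟨d :: p, x', y', ?_, by simp [e2], e3⟩
        rw [invRev_cons, e1]
        have : invRev [d] = [c] := by
          obtain ⟨c1, c2⟩ := c
          obtain ⟨d1, d2⟩ := d
          simp at hcd
          simp only [invRev, hcd.1]; cases c2 <;> cases d2 <;> simp_all
        rw [this]; simp

theorem red_mul (x y : F2) : ∃ p x' y', x.toWord = x' ++ invRev p ∧ y.toWord = p ++ y' ∧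
    (x * y).toWord = x' ++ y' := by
  obtain ⟨p, x', y', e1, e2, e3⟩ := red_decomp x.toWord y.toWord isReduced_toWord isReduced_toWord
  refine ⟨p, x', y', e1, e2, ?_⟩
  rw [← e3.reduce_eq, ← toWord_mk]
  congr 1
  rw [← mk_toWord (x := x), ← mk_toWord (x := y), e1, e2]
  simp only [← mul_mk, ← inv_mk]
  group

theorem norm_parity (x y : F2) : ∃ k, FreeGroup.norm x + FreeGroup.norm y = FreeGroup.norm (x * y) + 2 * k := by
  obtain ⟨p, x', y', e1, e2, e3⟩ := red_mul x y
  refine ⟨p.length, ?_⟩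
  simp only [FreeGroup.norm, e1, e2, e3, List.length_append, invRev_length]; ring

theorem norm_hyp (z v x : F2) (h : FreeGroup.norm z + FreeGroup.norm x < FreeGroup.norm (z * v) + FreeGroup.norm (v * x)) :
    FreeGroup.norm (z * v * x) + FreeGroup.norm v = FreeGroup.norm (z * v) + FreeGroup.norm (v * x) := by
  obtain ⟨p, z', v', e1, e2, e3⟩ := red_mul z v
  obtain ⟨q, v'', x', g1, g2, g3⟩ := red_mul v x
  have hl := congrArg List.length (e2.symm.trans g1)
  have hv : FreeGroup.norm v = p.length + v'.length := by simp [FreeGroup.norm, e2]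
  simp only [FreeGroup.norm, e1, e3, g2, g3, List.length_append, invRev_length] at h hl
  -- v = p ++ m ++ invRev q
  obtain ⟨m, hm1, hm2⟩ : ∃ m, v'' = p ++ m ∧ v' = m ++ invRev q := by
    have := e2.symm.trans g1
    rcases List.append_eq_append_iff.1 this with ⟨m, h1, h2⟩ | ⟨m, h1, h2⟩
    · exact ⟨m, h1, h2⟩
    · have := congrArg List.length h1
      have := congrArg List.length h2
      simp at *
      omega
  have hm : m ≠ [] := by
    rintro rfl
    simp [hm1, hm2] at h hl
    omega
  have r1 : FreeGroup.IsReduced (z' ++ m) := by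
    have := isReduced_toWord (x := z * v)
    rw [e3, hm2] at this
    exact this.part ⟨[], invRev q, by simp⟩
  have r2 : FreeGroup.IsReduced (m ++ x') := by
    have := isReduced_toWord (x := v * x)
    rw [g3, hm1] at this
    exact this.part ⟨p, [], by simp⟩
  have r3 := FreeGroup.IsReduced.append_overlap r1 r2 hm
  have : (z * v * x).toWord = z' ++ m ++ x' := by
    rw [← r3.reduce_eq, ← toWord_mk]
    congr 1
    rw [← mk_toWord (x := z * v), ← mk_toWord (x := x), e3, g2, hm2]
    simp only [← mul_mk, ← inv_mk]
    group
  simp only [FreeGroup.norm, this, e3, g3, e2, hm1, hm2, List.length_append, invRev_length]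
  omega

theorem norm_sq (x : F2) (hx : x ≠ 1) : FreeGroup.norm x < FreeGroup.norm (x * x) := by
  have h := reduceCyclically.reduce_flatten_replicate (isReduced_toWord (x := x)) 2
  have h1 := reduceCyclically.conj_conjugator_reduceCyclically x.toWord
  have h2 : (x * x).toWord = reduce (List.replicate 2 x.toWord).flatten := by
    rw [toWord_mul]; simp [List.replicate]
  simp only [FreeGroup.norm, h2, h]
  have h3 := congrArg List.length h1
  have h4 : reduceCyclically x.toWord ≠ [] := by
    intro h5
    rw [h5] at h1
    apply hx
    rw [← mk_toWord (x := x), ← h1]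
    rw [List.append_nil, ← mul_mk, ← inv_mk, mul_inv_cancel]
  have := List.length_pos_iff.2 h4
  simp [List.replicate] at h3 ⊢
  omega

theorem half_lemma (u v w : F2) (h1 : FreeGroup.norm (u * v) = FreeGroup.norm u) (h2 : FreeGroup.norm (v * w) = FreeGroup.norm w) :
    ∃ P Q u' w', v.toWord = P ++ Q ∧ P.length = Q.length ∧ u.toWord = u' ++ invRev P ∧
      w.toWord = invRev Q ++ w' := by
  obtain ⟨p, z', v', e1, e2, e3⟩ := red_mul u v
  obtain ⟨q, v'', x', g1, g2, g3⟩ := red_mul v w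
  simp only [FreeGroup.norm, e1, e3, g2, g3, List.length_append, invRev_length] at h1 h2
  have hl := congrArg List.length (e2.symm.trans g1)
  simp at hl
  have := List.append_inj (e2.symm.trans g1) (by omega)
  refine ⟨p, v', z', x', e2, by omega, e1, ?_⟩
  rw [this.2, invRev_invRev]; exact g2

/-- the growth claim -/
theorem growth (U : Fin 2 × Bool → F2)
    (N0 : ∀ c, U c ≠ 1)
    (N1 : ∀ c d : Fin 2 × Bool, (c.1 = d.1 → c.2 = d.2) →
      FreeGroup.norm (U c) ≤ FreeGroup.norm (U c * U d) ∧ FreeGroup.norm (U d) ≤ FreeGroup.norm (U c * U d))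
    (N2 : ∀ c d e : Fin 2 × Bool, (c.1 = d.1 → c.2 = d.2) → (d.1 = e.1 → d.2 = e.2) →
      FreeGroup.norm (U c) + FreeGroup.norm (U e) < FreeGroup.norm (U c * U d) + FreeGroup.norm (U d * U e)) :
    ∀ (l : List (Fin 2 × Bool)) (c : Fin 2 × Bool), FreeGroup.IsReduced (c :: l) →
      ∀ e : Fin 2 × Bool, (e.1 = c.1 → e.2 = c.2) →
      FreeGroup.norm (U e * ((c :: l).map U).prod) + FreeGroup.norm (U c) = FreeGroup.norm (((c :: l).map U).prod) + FreeGroup.norm (U e * U c) ∧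
      2 * FreeGroup.norm (((c :: l).map U).prod) + FreeGroup.norm (U e * U c) ≥ 2 * (l.length + 1) + FreeGroup.norm (U e) + FreeGroup.norm (U c) := by
  intro l
  induction l with
  | nil =>
    intro c _ e hec
    have h0 : FreeGroup.norm (U c) ≠ 0 := fun h => N0 c (FreeGroup.norm_eq_zero.1 h)
    have h1 := N1 e c hec
    obtain ⟨k, hk⟩ := norm_parity (U e) (U c)
    simp
    omega
  | cons d l ih =>
    intro c hr e hec
    have hr' : FreeGroup.IsReduced (d :: l) := hr.part ⟨[c], [], by simp⟩
    have hcd : c.1 = d.1 → c.2 = d.2 := by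
      unfold FreeGroup.IsReduced at hr
      rw [List.isChain_cons_cons] at hr
      exact hr.1
    obtain ⟨a1, a2⟩ := ih d hr' c hcd
    have n2 := N2 e c d hec hcd
    have hm : ((c :: d :: l).map U).prod = U c * ((d :: l).map U).prod := by simp
    rw [hm]
    set z := ((d :: l).map U).prod with hz
    have hh := norm_hyp (U e) (U c) z (by omega)
    obtain ⟨k, hk⟩ := norm_parity (U e) (U c)
    obtain ⟨k', hk'⟩ := norm_parity (U c) (U d)
    rw [← mul_assoc]
    simp only [List.length_cons]
    omega

theorem opp_of_ne (c d : Fin 2 × Bool) (h : c.1 = d.1) (h2 : c.2 ≠ d.2) : c = (d.1, !d.2) := by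
  revert c d; decide

theorem not_cyclic (x : F2) (h : Subgroup.closure {x} = (⊤ : Subgroup F2)) : False := by
  have h1 : (FreeGroup.of 0 : F2) ∈ Subgroup.closure {x} := by rw [h]; trivial
  have h2 : (FreeGroup.of 1 : F2) ∈ Subgroup.closure {x} := by rw [h]; trivial
  rw [Subgroup.mem_closure_singleton] at h1 h2
  obtain ⟨n, hn⟩ := h1
  obtain ⟨m, hm⟩ := h2
  have : (FreeGroup.of 0 * FreeGroup.of 1 : F2) = FreeGroup.of 1 * FreeGroup.of 0 := by
    rw [← hn, ← hm, ← zpow_add, ← zpow_add, add_comm]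
  revert this
  decide

/-- value of a letter under the map sending `a` to `X` and `b` to `Y` -/
def Uval (X Y : F2) (c : Fin 2 × Bool) : F2 :=
  match c with
  | (0, true) => X
  | (0, false) => X⁻¹
  | (1, true) => Y
  | (1, false) => Y⁻¹

theorem Uval_not (X Y : F2) (c : Fin 2 × Bool) : Uval X Y (c.1, !c.2) = (Uval X Y c)⁻¹ := by
  obtain ⟨i, s⟩ := c
  fin_cases i <;> cases s <;> simp [Uval]

theorem lift_mk_eq (X Y : F2) (l : List (Fin 2 × Bool)) :
    FreeGroup.lift ![X, Y] (FreeGroup.mk l) = (l.map (Uval X Y)).prod := by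
  rw [FreeGroup.lift_mk]
  congr 1
  apply List.map_congr_left
  rintro ⟨i, s⟩ _
  fin_cases i <;> cases s <;> simp [Uval]

theorem len_one_eq (x : F2) (h : FreeGroup.norm x = 1) : ∃ c, x = FreeGroup.mk [c] := by
  obtain ⟨c, hc⟩ := List.length_eq_one_iff.1 h
  exact ⟨c, by rw [← hc, mk_toWord]⟩

set_option maxHeartbeats 2000000 in
theorem nielsen (A : F2 → F2 → Prop) (hswap : ∀ X Y, A X Y → A Y X)
    (hinv : ∀ X Y, A X⁻¹ Y → A X Y) (hmul : ∀ X Y, A X (X * Y) → A X Y)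
    (hconj : ∀ g X Y, A (g * X * g⁻¹) (g * Y * g⁻¹) → A X Y)
    (hbase : A (FreeGroup.of 0) (FreeGroup.of 1)) :
    ∀ n X Y, FreeGroup.norm X + FreeGroup.norm Y = n → Subgroup.closure {X, Y} = (⊤ : Subgroup F2) → A X Y := by
  intro n
  induction n using Nat.strong_induction_on with
  | _ n ih =>
  intro X Y hn hcl
  by_contra hA
  set U := Uval X Y with hU
  have hinv2 : ∀ X Y, A X Y⁻¹ → A X Y := fun X Y h => hswap _ _ (hinv _ _ (hswap _ _ h))
  have UA : ∀ c d : Fin 2 × Bool, c.1 ≠ d.1 → ¬ A (U c) (U d) := by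
    rintro ⟨i, s⟩ ⟨j, t⟩ hij h
    apply hA
    fin_cases i <;> fin_cases j <;> simp at hij <;> cases s <;> cases t <;> simp [U, Uval] at h
    · exact hinv _ _ (hinv2 _ _ h)
    · exact hinv _ _ h
    · exact hinv2 _ _ h
    · exact h
    · exact hinv _ _ (hinv2 _ _ (hswap _ _ h))
    · exact hinv2 _ _ (hswap _ _ h)
    · exact hinv _ _ (hswap _ _ h)
    · exact (hswap _ _ h)
  have Un : ∀ c d : Fin 2 × Bool, c.1 ≠ d.1 → FreeGroup.norm (U c) + FreeGroup.norm (U d) = n := by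
    rintro ⟨i, s⟩ ⟨j, t⟩ hij
    fin_cases i <;> fin_cases j <;> simp at hij <;> cases s <;> cases t <;> simp [U, Uval] <;> omega
  have Ucl : ∀ c d : Fin 2 × Bool, c.1 ≠ d.1 → ∀ H : Subgroup F2, U c ∈ H → U d ∈ H → H = ⊤ := by
    rintro ⟨i, s⟩ ⟨j, t⟩ hij H h1 h2
    rw [eq_top_iff, ← hcl, Subgroup.closure_le]
    fin_cases i <;> fin_cases j <;> simp at hij <;> cases s <;> cases t <;>
      simp [U, Uval] at h1 h2 <;> simp [Set.insert_subset_iff, h1, h2]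
  have other : ∀ c : Fin 2 × Bool, ∃ d : Fin 2 × Bool, c.1 ≠ d.1 := by
    rintro ⟨i, s⟩
    fin_cases i
    · exact ⟨(1, true), by simp⟩
    · exact ⟨(0, true), by simp⟩
  have N0 : ∀ c, U c ≠ 1 := by
    intro c hc
    obtain ⟨d, hd⟩ := other c
    apply not_cyclic (U d)
    apply Ucl c d hd
    · rw [hc]; exact one_mem _
    · exact Subgroup.subset_closure rfl
  have M1 : ∀ c d : Fin 2 × Bool, c.1 ≠ d.1 → FreeGroup.norm (U d) ≤ FreeGroup.norm (U c * U d) := by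
    intro c d hcd
    by_contra hlt
    push Not at hlt
    apply UA c d hcd
    apply hmul
    refine ih _ ?_ _ _ rfl ?_
    · have := Un c d hcd; omega
    · have m1 : U c ∈ Subgroup.closure {U c, U c * U d} := Subgroup.subset_closure (by simp)
      have m2 : U c * U d ∈ Subgroup.closure {U c, U c * U d} := Subgroup.subset_closure (by simp)
      exact Ucl c d hcd _ m1 ((Subgroup.mul_mem_cancel_left _ m1).1 m2)
  have M2 : ∀ c d : Fin 2 × Bool, c.1 ≠ d.1 → FreeGroup.norm (U c) ≤ FreeGroup.norm (U c * U d) := by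
    intro c d hcd
    have := M1 (d.1, !d.2) (c.1, !c.2) (Ne.symm hcd)
    simp only [U, Uval_not, ← mul_inv_rev, FreeGroup.norm_inv_eq] at this
    exact this
  have N1 : ∀ c d : Fin 2 × Bool, (c.1 = d.1 → c.2 = d.2) →
      FreeGroup.norm (U c) ≤ FreeGroup.norm (U c * U d) ∧ FreeGroup.norm (U d) ≤ FreeGroup.norm (U c * U d) := by
    intro c d hcd
    by_cases h : c.1 = d.1
    · have : c = d := Prod.ext h (hcd h)
      subst this
      have := norm_sq (U c) (N0 c)
      omega
    · exact ⟨M2 c d h, M1 c d h⟩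
  have N2 : ∀ c d e : Fin 2 × Bool, (c.1 = d.1 → c.2 = d.2) → (d.1 = e.1 → d.2 = e.2) →
      FreeGroup.norm (U c) + FreeGroup.norm (U e) < FreeGroup.norm (U c * U d) + FreeGroup.norm (U d * U e) := by
    intro c d e hcd hde
    have n1 := N1 c d hcd
    have n2 := N1 d e hde
    by_cases h : c.1 = d.1
    · have : c = d := Prod.ext h (hcd h)
      subst this
      have := norm_sq (U c) (N0 c)
      omega
    by_cases h' : d.1 = e.1
    · have : d = e := Prod.ext h' (hde h')
      subst this
      have := norm_sq (U d) (N0 d)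
      omega
    by_contra hlt
    have hce : c.1 = e.1 := by omega
    obtain ⟨P, Q, u', w', p1, p2, p3, p4⟩ := half_lemma (U c) (U d) (U e) (by omega) (by omega)
    by_cases h2 : c.2 = e.2
    · have : c = e := Prod.ext hce h2
      subst this
      -- the simultaneous conjugation case
      have hlen : P.length + Q.length ≤ u'.length + P.length := by
        have e1 : FreeGroup.norm (U d) = P.length + Q.length := by simp [FreeGroup.norm, p1]
        have e2 : FreeGroup.norm (U c) = u'.length + P.length := by simp [FreeGroup.norm, p3]
        omega
      obtain ⟨t, ht⟩ : ∃ t, u' = invRev Q ++ t := by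
        rcases List.append_eq_append_iff.1 (p3.symm.trans p4) with ⟨t, h1, h2⟩ | ⟨t, h1, h2⟩
        · have := congrArg List.length h1
          simp at this
          have : t = [] := List.length_eq_zero_iff.1 (by omega)
          subst this
          exact ⟨[], by simpa using h1.symm⟩
        · exact ⟨t, h1⟩
      have hc : U c = (mk Q)⁻¹ * mk t * (mk P)⁻¹ := by
        rw [← mk_toWord (x := U c), p3, ht]; simp only [← mul_mk, ← inv_mk]
      have hd : U d = mk P * mk Q := by
        rw [← mk_toWord (x := U d), p1]; simp only [← mul_mk]
      have k1 : mk Q * U d * (mk Q)⁻¹ = mk (Q ++ P) := by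
        rw [hd, ← mul_mk]; group
      have k2 : mk Q * (U c * U d) * (mk Q)⁻¹ = mk t := by
        rw [hc, hd]; group
      apply UA d c (Ne.symm h)
      apply hmul
      apply hconj (mk Q * (U d)⁻¹)
      have k3 : mk Q * (U d)⁻¹ * U d * (mk Q * (U d)⁻¹)⁻¹ = mk Q * U d * (mk Q)⁻¹ := by group
      have k4 : mk Q * (U d)⁻¹ * (U d * U c) * (mk Q * (U d)⁻¹)⁻¹ = mk Q * (U c * U d) * (mk Q)⁻¹ := by group
      rw [k3, k4]
      refine ih _ ?_ _ _ rfl ?_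
      · rw [k1, k2]
        have b1 : FreeGroup.norm (mk (Q ++ P)) ≤ (Q ++ P).length := FreeGroup.norm_mk_le
        have b2 : FreeGroup.norm (mk t) ≤ t.length := FreeGroup.norm_mk_le
        have e1 : FreeGroup.norm (U d) = P.length + Q.length := by simp [FreeGroup.norm, p1]
        have e2 : FreeGroup.norm (U c) = Q.length + t.length + P.length := by simp [FreeGroup.norm, p3, ht]; omega
        have e3 : FreeGroup.norm (U d) ≠ 0 := fun h => N0 d (FreeGroup.norm_eq_zero.1 h)
        have := Un c d h
        simp at b1
        omega
      · set K := Subgroup.closure {mk Q * U d * (mk Q)⁻¹, mk Q * (U c * U d) * (mk Q)⁻¹} with hK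
        have m1 : mk Q * U d * (mk Q)⁻¹ ∈ K := Subgroup.subset_closure (by simp)
        have m2 : mk Q * (U c * U d) * (mk Q)⁻¹ ∈ K := Subgroup.subset_closure (by simp)
        have m3 : mk Q * U c * (mk Q)⁻¹ ∈ K := by
          have := K.mul_mem m2 (K.inv_mem m1)
          convert this using 1
          group
        have := Ucl c d h (K.comap (MulAut.conj (mk Q)).toMonoidHom) (by simpa using m3) (by simpa using m1)
        rw [eq_top_iff]
        intro x _
        have h5 : (mk Q)⁻¹ * x * (mk Q) ∈ (K.comap (MulAut.conj (mk Q)).toMonoidHom) := by rw [this]; trivial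
        have h6 : mk Q * ((mk Q)⁻¹ * x * (mk Q)) * (mk Q)⁻¹ ∈ K := by simpa using h5
        convert h6 using 1
        group
    · have hec : e = (c.1, !c.2) := opp_of_ne _ _ hce.symm (Ne.symm h2)
      rw [hec, hU, Uval_not, ← hU, toWord_inv, p3, invRev_append, invRev_invRev] at p4
      have := List.append_inj p4 (by simp [p2])
      apply N0 d
      rw [← mk_toWord (x := U d), p1, ← mul_mk, this.1, ← inv_mk, inv_mul_cancel]
  have G := growth U N0 N1 N2
  have key : ∀ x : F2, ∃ l, FreeGroup.IsReduced l ∧ x = (l.map U).prod ∧ l.length ≤ FreeGroup.norm x := by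
    intro x
    have hx : x ∈ (FreeGroup.lift ![X, Y]).range := by
      have : (FreeGroup.lift ![X, Y]).range = ⊤ := by
        rw [FreeGroup.range_lift_eq_closure, ← hcl, Matrix.range_cons_cons_empty]
      rw [this]; trivial
    obtain ⟨y, rfl⟩ := hx
    refine ⟨y.toWord, isReduced_toWord, ?_, ?_⟩
    · conv_lhs => rw [← mk_toWord (x := y)]
      exact lift_mk_eq X Y _
    · have e : FreeGroup.lift ![X, Y] y = (y.toWord.map U).prod := by
        conv_lhs => rw [← mk_toWord (x := y)]
        exact lift_mk_eq X Y _
      rw [e]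
      have hr := isReduced_toWord (x := y)
      cases hy : y.toWord with
      | nil => simp
      | cons c l =>
        rw [hy] at hr
        have h2 := (G l c hr c (fun _ => rfl)).2
        obtain ⟨k, hk⟩ := norm_parity (U c) (U c)
        simp only [List.length_cons]
        omega
  have letter : ∀ i : Fin 2, ∃ c, (FreeGroup.of i : F2) = U c := by
    intro i
    obtain ⟨l, h1, h2, h3⟩ := key (FreeGroup.of i)
    rw [FreeGroup.norm_of] at h3
    match l, h3 with
    | [], _ => simp at h2
    | [c], _ => exact ⟨c, by simpa using h2⟩
  obtain ⟨c, hc⟩ := letter 0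
  obtain ⟨d, hd⟩ := letter 1
  by_cases h : c.1 = d.1
  · by_cases h2 : c.2 = d.2
    · have : c = d := Prod.ext h h2
      rw [this, ← hd] at hc
      revert hc; decide
    · have : c = (d.1, !d.2) := opp_of_ne _ _ h h2
      rw [this, hU, Uval_not, ← hU, ← hd] at hc
      revert hc; decide
  · apply UA c d h
    rw [← hc, ← hd]
    exact hbase

theorem ga_eq : (FreeGroup.of 0 : F2) = ga := rfl
theorem gb_eq : (FreeGroup.of 1 : F2) = gb := rfl

def mk2 (X Y : F2) : F2 →* F2 := FreeGroup.lift ![X, Y]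

@[simp] theorem mk2_a (X Y : F2) : mk2 X Y ga = X := by simp [mk2, ga]
@[simp] theorem mk2_b (X Y : F2) : mk2 X Y gb = Y := by simp [mk2, gb]

theorem hom_eq (f g : F2 →* F2) (h1 : f ga = g ga) (h2 : f gb = g gb) (v : F2) : f v = g v := by
  have : f = g := by
    apply FreeGroup.ext_hom
    intro i
    fin_cases i
    · exact h1
    · exact h2
  rw [this]

theorem hom_eq_conj (f g : F2 →* F2) (c : F2) (h1 : f ga = c * g ga * c⁻¹) (h2 : f gb = c * g gb * c⁻¹)
    (v : F2) : f v = c * g v * c⁻¹ :=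
  hom_eq f ((MulAut.conj c).toMonoidHom.comp g) (by simpa using h1) (by simpa using h2) v

def mL : F2 →* F2 := mk2 ga (ga * gb)
def mL' : F2 →* F2 := mk2 ga (ga⁻¹ * gb)
def mR : F2 →* F2 := mk2 (gb * ga) gb
def mR' : F2 →* F2 := mk2 (gb⁻¹ * ga) gb
def mD : F2 →* F2 := mk2 ga gb⁻¹
def mE : F2 →* F2 := mk2 gb ga

theorem mDD (v : F2) : mD (mD v) = v :=
  hom_eq (mD.comp mD) (MonoidHom.id _) (by simp [mD]) (by simp [mD]) v
theorem mEE (v : F2) : mE (mE v) = v :=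
  hom_eq (mE.comp mE) (MonoidHom.id _) (by simp [mE]) (by simp [mE]) v
theorem mL'L (v : F2) : mL' (mL v) = v :=
  hom_eq (mL'.comp mL) (MonoidHom.id _) (by simp [mL, mL']) (by simp [mL, mL']) v
theorem mR'R (v : F2) : mR' (mR v) = v :=
  hom_eq (mR'.comp mR) (MonoidHom.id _) (by simp [mR, mR']) (by simp [mR, mR']) v
theorem mLL' (v : F2) : mL (mL' v) = v :=
  hom_eq (mL.comp mL') (MonoidHom.id _) (by simp [mL, mL']) (by simp [mL, mL']) v
theorem mL_D (v : F2) : mL (mD v) = ga * mD (mL' v) * ga⁻¹ :=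
  hom_eq_conj (mL.comp mD) (mD.comp mL') ga (by simp [mL, mL', mD]) (by simp [mL, mL', mD]) v
theorem mL'_D (v : F2) : mL' (mD v) = ga⁻¹ * mD (mL v) * ga⁻¹⁻¹ :=
  hom_eq_conj (mL'.comp mD) (mD.comp mL) ga⁻¹ (by simp [mL, mL', mD]) (by simp [mL, mL', mD]) v
theorem mR_D (v : F2) : mR (mD v) = mD (mR' v) :=
  hom_eq (mR.comp mD) (mD.comp mR') (by simp [mR, mR', mD]) (by simp [mR, mR', mD]) v
theorem mR'_D (v : F2) : mR' (mD v) = mD (mR v) :=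
  hom_eq (mR'.comp mD) (mD.comp mR) (by simp [mR, mR', mD]) (by simp [mR, mR', mD]) v
theorem mL_E (v : F2) : mL (mE v) = mE (mR v) :=
  hom_eq (mL.comp mE) (mE.comp mR) (by simp [mL, mR, mE]) (by simp [mL, mR, mE]) v
theorem mR_E (v : F2) : mR (mE v) = mE (mL v) :=
  hom_eq (mR.comp mE) (mE.comp mL) (by simp [mL, mR, mE]) (by simp [mL, mR, mE]) v
theorem mL'_E (v : F2) : mL' (mE v) = mE (mR' v) :=
  hom_eq (mL'.comp mE) (mE.comp mR') (by simp [mL', mR', mE]) (by simp [mL', mR', mE]) v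
theorem mR'_E (v : F2) : mR' (mE v) = mE (mL' v) :=
  hom_eq (mR'.comp mE) (mE.comp mL') (by simp [mL', mR', mE]) (by simp [mL', mR', mE]) v
theorem mL'_R (v : F2) : mL' (mR v) = ga⁻¹ * mE (mD (mL v)) * ga⁻¹⁻¹ :=
  hom_eq_conj (mL'.comp mR) (mE.comp (mD.comp mL)) ga⁻¹ (by simp [mL, mL', mR, mD, mE])
    (by simp [mL, mL', mR, mD, mE]; group) v
theorem mR'_L (v : F2) : mR' (mL v) = gb⁻¹ * mD (mE (mR v)) * gb⁻¹⁻¹ :=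
  hom_eq_conj (mR'.comp mL) (mD.comp (mE.comp mR)) gb⁻¹ (by simp [mL, mR', mR, mD, mE]; group)
    (by simp [mL, mR', mR, mD, mE]) v

inductive BB (w : F2) : F2 → Prop
  | base : BB w w
  | based : BB w (mD w)
  | L (v) : BB w v → BB w (mL v)
  | R (v) : BB w v → BB w (mR v)

inductive QQ (w : F2) : F2 → Prop
  | ofB (v) : BB w v → QQ w v
  | D (v) : QQ w v → QQ w (mD v)
  | E (v) : QQ w v → QQ w (mE v)
  | conj (g v) : QQ w v → QQ w (g * v * g⁻¹)

theorem QQ_closed (w v : F2) (h : QQ w v) : QQ w (mL v) ∧ QQ w (mL' v) ∧ QQ w (mR v) ∧ QQ w (mR' v) := by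
  induction h with
  | ofB v hv =>
    refine ⟨.ofB _ (.L _ hv), ?_, .ofB _ (.R _ hv), ?_⟩
    · cases hv with
      | base =>
        have := mL'_D (mD w)
        rw [mDD] at this
        rw [this]
        exact .conj _ _ (.D _ (.ofB _ (.L _ .based)))
      | based =>
        rw [mL'_D]
        exact .conj _ _ (.D _ (.ofB _ (.L _ .base)))
      | L u hu => rw [mL'L]; exact .ofB _ hu
      | R u hu =>
        rw [mL'_R]
        exact .conj _ _ (.E _ (.D _ (.ofB _ (.L _ hu))))
    · cases hv with
      | base =>
        have := mR'_D (mD w)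
        rw [mDD] at this
        rw [this]
        exact (.D _ (.ofB _ (.R _ .based)))
      | based =>
        rw [mR'_D]
        exact (.D _ (.ofB _ (.R _ .base)))
      | R u hu => rw [mR'R]; exact .ofB _ hu
      | L u hu =>
        rw [mR'_L]
        exact .conj _ _ (.D _ (.E _ (.ofB _ (.R _ hu))))
  | D v _ ih =>
    obtain ⟨i1, i2, i3, i4⟩ := ih
    rw [mL_D, mL'_D, mR_D, mR'_D]
    exact ⟨.conj _ _ (.D _ i2), .conj _ _ (.D _ i1), .D _ i4, .D _ i3⟩
  | E v _ ih =>
    obtain ⟨i1, i2, i3, i4⟩ := ih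
    rw [mL_E, mL'_E, mR_E, mR'_E]
    exact ⟨.E _ i3, .E _ i4, .E _ i1, .E _ i2⟩
  | conj g v _ ih =>
    obtain ⟨i1, i2, i3, i4⟩ := ih
    simp only [_root_.map_mul, _root_.map_inv]
    exact ⟨.conj _ _ i1, .conj _ _ i2, .conj _ _ i3, .conj _ _ i4⟩

theorem QQ_aut (w : F2) (φ : F2 ≃* F2) : QQ w (φ w) := by
  have key := nielsen (fun X Y => ∀ v, QQ w v → QQ w (mk2 X Y v)) ?_ ?_ ?_ ?_ ?_
    _ (φ ga) (φ gb) rfl ?_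
  · have := key w (.ofB _ .base)
    rwa [hom_eq (mk2 (φ ga) (φ gb)) φ.toMonoidHom (by simp) (by simp) w] at this
  · intro X Y h v hv
    have := h _ (.E _ hv)
    rwa [hom_eq ((mk2 X Y).comp mE) (mk2 Y X) (by simp [mE]) (by simp [mE]) v |>.symm]
  · intro X Y h v hv
    have := h _ (.E _ (.D _ (.E _ hv)))
    rwa [hom_eq ((mk2 X⁻¹ Y).comp (mE.comp (mD.comp mE))) (mk2 X Y) (by simp [mE, mD])
      (by simp [mE, mD]) v |>.symm]
  · intro X Y h v hv
    have := h _ (QQ_closed _ _ hv).2.1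
    rwa [hom_eq ((mk2 X (X * Y)).comp mL') (mk2 X Y) (by simp [mL'])
      (by simp [mL']) v |>.symm]
  · intro g X Y h v hv
    have := QQ.conj g⁻¹ _ (h _ hv)
    rwa [← hom_eq_conj (mk2 X Y) (mk2 (g * X * g⁻¹) (g * Y * g⁻¹)) g⁻¹ (by simp; group)
      (by simp; group) v] at this
  · intro v hv
    rwa [hom_eq (mk2 _ _) (MonoidHom.id _) (by simp; rfl)
      (by simp; rfl) v]
  · have h1 : Subgroup.closure {φ ga, φ gb} = (Subgroup.closure {ga, gb}).map φ.toMonoidHom := by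
      rw [MonoidHom.map_closure]
      simp [Set.image_pair]
    have h2 : Subgroup.closure {ga, gb} = (⊤ : Subgroup F2) := by
      rw [← FreeGroup.closure_range_of]
      congr 1
      ext x
      simp [Fin.exists_fin_two, ga, gb, eq_comm]
    rw [h1, h2]
    exact Subgroup.map_top_of_surjective _ φ.surjective

/-! Unidirectional elements -/

def Bad (v : F2) : Prop :=
  ∃ (c1 c2 : Fin 2 × Bool) (h : F2) (l : List (Fin 2 × Bool)), (∀ x ∈ l, x = c1 ∨ x = c2) ∧
    v = h * mk l * h⁻¹

def dlet (c : Fin 2 × Bool) : Fin 2 × Bool := if c.1 = 1 then (1, !c.2) else c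
def elet (c : Fin 2 × Bool) : Fin 2 × Bool := (1 - c.1, c.2)

theorem mD_mk (l : List (Fin 2 × Bool)) : mD (mk l) = mk (l.map dlet) := by
  induction l with
  | nil => exact _root_.map_one _
  | cons c l ih =>
    have h : ∀ c, mD (mk [c]) = mk [dlet c] := by decide
    rw [List.map_cons, ← List.singleton_append, ← mul_mk, _root_.map_mul, ih, h, mul_mk, List.singleton_append]

theorem mE_mk (l : List (Fin 2 × Bool)) : mE (mk l) = mk (l.map elet) := by
  induction l with
  | nil => exact _root_.map_one _
  | cons c l ih =>
    have h : ∀ c, mE (mk [c]) = mk [elet c] := by decide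
    rw [List.map_cons, ← List.singleton_append, ← mul_mk, _root_.map_mul, ih, h, mul_mk, List.singleton_append]

theorem Bad_D (v : F2) (h : Bad v) : Bad (mD v) := by
  obtain ⟨c1, c2, h, l, hl, rfl⟩ := h
  refine ⟨dlet c1, dlet c2, mD h, l.map dlet, ?_, by rw [_root_.map_mul, _root_.map_mul, _root_.map_inv, mD_mk]⟩
  intro x hx
  obtain ⟨y, hy, rfl⟩ := List.mem_map.1 hx
  rcases hl y hy with rfl | rfl <;> simp

theorem Bad_E (v : F2) (h : Bad v) : Bad (mE v) := by
  obtain ⟨c1, c2, h, l, hl, rfl⟩ := h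
  refine ⟨elet c1, elet c2, mE h, l.map elet, ?_, by rw [_root_.map_mul, _root_.map_mul, _root_.map_inv, mE_mk]⟩
  intro x hx
  obtain ⟨y, hy, rfl⟩ := List.mem_map.1 hx
  rcases hl y hy with rfl | rfl <;> simp

theorem Bad_of_pos (v : F2) (h : Positive2 v) : Bad v := by
  suffices h : ∃ l : List (Fin 2 × Bool), (∀ x ∈ l, x = (0, true) ∨ x = (1, true)) ∧ v = mk l by
    obtain ⟨l, h1, h2⟩ := h
    exact ⟨_, _, 1, l, h1, by simp [h2]⟩
  unfold Positive2 at h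
  induction h using Submonoid.closure_induction with
  | mem x hx =>
    obtain ⟨i, rfl⟩ := hx
    refine ⟨[(i, true)], ?_, rfl⟩
    fin_cases i <;> simp
  | one => exact ⟨[], by simp, rfl⟩
  | mul x y _ _ hx hy =>
    obtain ⟨l, h1, rfl⟩ := hx
    obtain ⟨l', h2, rfl⟩ := hy
    refine ⟨l ++ l', ?_, by rw [mul_mk]⟩
    intro z hz
    rcases List.mem_append.1 hz with h | h
    · exact h1 z h
    · exact h2 z h

theorem QQ_notBad (w : F2) (hB : ∀ v, BB w v → ¬ Bad v) (v : F2) (h : QQ w v) : ¬ Bad v := by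
  induction h with
  | ofB v hv => exact hB v hv
  | D v _ ih => intro h; apply ih; have := Bad_D _ h; rwa [mDD] at this
  | E v _ ih => intro h; apply ih; have := Bad_E _ h; rwa [mEE] at this
  | conj g v _ ih =>
    rintro ⟨c1, c2, h, l, hl, e⟩
    apply ih
    refine ⟨c1, c2, g⁻¹ * h, l, hl, ?_⟩
    have : v = g⁻¹ * (g * v * g⁻¹) * g := by group
    rw [this, e]; group

theorem reduction (w : F2) (hB : ∀ v, BB w v → ¬ Bad v) : ¬ PotPos2 w := by
  rintro ⟨φ, h⟩
  exact QQ_notBad w hB _ (QQ_aut w φ) (Bad_of_pos _ h)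

/-! Tracking first and last letters -/

abbrev LL := Fin 2 × Bool
abbrev la : LL := (0, true)
abbrev lA : LL := (0, false)
abbrev lb : LL := (1, true)
abbrev lB : LL := (1, false)

def linv (c : LL) : LL := (c.1, !c.2)

def Cmp (c d : LL) : Prop := c.1 = d.1 → c.2 = d.2

instance (c d : LL) : Decidable (Cmp c d) := by unfold Cmp; infer_instance

def St (c : LL) (x : F2) : Prop := x.toWord.head? = some c

theorem St_mul (c : LL) (x : F2) (h : ¬ St (linv c) x) : St c (mk [c] * x) := by
  unfold St at *
  have hx : IsReduced x.toWord := isReduced_toWord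
  have h2 : FreeGroup.IsReduced (c :: x.toWord) := by
    cases hw : x.toWord with
    | nil => simp
    | cons d l =>
      rw [hw] at hx h
      rw [FreeGroup.isReduced_cons_cons]
      refine ⟨?_, hx⟩
      intro e
      by_contra hne
      apply h
      simp only [List.head?_cons, linv, Option.some.injEq]
      ext
      · simp [e]
      · simp only
        cases h1 : c.2 <;> cases h3 : d.2 <;> simp_all
  have : (mk [c] * x).toWord = c :: x.toWord := by
    conv_lhs => rw [← mk_toWord (x := x), mul_mk]
    rw [toWord_mk, List.singleton_append]
    exact h2.reduce_eq
  rw [this]; rfl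

theorem St_uniq {c d : LL} {x : F2} (h : St c x) (hcd : c ≠ d) : ¬ St d x := by
  unfold St at *
  rw [h]
  simpa using hcd

theorem St_la (x : F2) (h : ¬ St lA x) : St la (ga * x) := St_mul la x h
theorem St_lA (x : F2) (h : ¬ St la x) : St lA (ga⁻¹ * x) := St_mul lA x h
theorem St_lb (x : F2) (h : ¬ St lB x) : St lb (gb * x) := St_mul lb x h
theorem St_lB (x : F2) (h : ¬ St lb x) : St lB (gb⁻¹ * x) := St_mul lB x h

theorem St_la_of (y : F2) (h : St lb (ga⁻¹ * y)) : St la y := by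
  have := St_la (ga⁻¹ * y) (St_uniq h (by decide))
  simpa using this

def TT (c : LL) (y : F2) : Prop :=
  if c = la then St la y ∧ ¬ St lb (ga⁻¹ * y)
  else if c = lb then St lb (ga⁻¹ * y)
  else if c = lB then St lB y
  else St lA y ∨ St lb y

theorem TT_la (y : F2) : TT la y ↔ St la y ∧ ¬ St lb (ga⁻¹ * y) := by simp [TT]
theorem TT_lb (y : F2) : TT lb y ↔ St lb (ga⁻¹ * y) := by simp [TT]
theorem TT_lB (y : F2) : TT lB y ↔ St lB y := by simp [TT]
theorem TT_lA (y : F2) : TT lA y ↔ St lA y ∨ St lb y := by simp [TT]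

theorem LL_cases (P : LL → Prop) (h1 : P la) (h2 : P lA) (h3 : P lb) (h4 : P lB) (c : LL) : P c := by
  obtain ⟨i, b⟩ := c
  fin_cases i <;> cases b <;> assumption

theorem mL_la : mL (mk [la]) = ga := mk2_a _ _
theorem mL_lb : mL (mk [lb]) = ga * gb := mk2_b _ _
theorem mL_lA : mL (mk [lA]) = ga⁻¹ := by
  rw [show (mk [lA] : F2) = ga⁻¹ from rfl, _root_.map_inv]; exact congrArg _ mL_la
theorem mL_lB : mL (mk [lB]) = (ga * gb)⁻¹ := by
  rw [show (mk [lB] : F2) = gb⁻¹ from rfl, _root_.map_inv]; exact congrArg _ mL_lb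

theorem TT_step (c d : LL) (y : F2) (h : TT d y) (hcd : Cmp c d) : TT c (mL (mk [c]) * y) := by
  induction c using LL_cases with
  | h1 =>
    rw [mL_la, TT_la, inv_mul_cancel_left]
    induction d using LL_cases with
    | h1 => rw [TT_la] at h; exact ⟨St_la _ (St_uniq h.1 (by decide)), St_uniq h.1 (by decide)⟩
    | h2 => exact absurd hcd (by decide)
    | h3 =>
      rw [TT_lb] at h
      have := St_la_of _ h
      exact ⟨St_la _ (St_uniq this (by decide)), St_uniq this (by decide)⟩
    | h4 => rw [TT_lB] at h; exact ⟨St_la _ (St_uniq h (by decide)), St_uniq h (by decide)⟩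
  | h2 =>
    rw [mL_lA, TT_lA]
    induction d using LL_cases with
    | h1 => exact absurd hcd (by decide)
    | h2 =>
      rw [TT_lA] at h
      rcases h with h | h
      · exact .inl (St_lA _ (St_uniq h (by decide)))
      · exact .inl (St_lA _ (St_uniq h (by decide)))
    | h3 => rw [TT_lb] at h; exact .inr h
    | h4 => rw [TT_lB] at h; exact .inl (St_lA _ (St_uniq h (by decide)))
  | h3 =>
    rw [mL_lb, TT_lb, mul_assoc, inv_mul_cancel_left]
    apply St_lb
    induction d using LL_cases with
    | h1 => rw [TT_la] at h; exact St_uniq h.1 (by decide)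
    | h2 => rw [TT_lA] at h; rcases h with h | h <;> exact St_uniq h (by decide)
    | h3 => rw [TT_lb] at h; exact St_uniq (St_la_of _ h) (by decide)
    | h4 => exact absurd hcd (by decide)
  | h4 =>
    rw [mL_lB, TT_lB, mul_inv_rev, mul_assoc]
    apply St_lB
    induction d using LL_cases with
    | h1 => rw [TT_la] at h; exact h.2
    | h2 =>
      rw [TT_lA] at h
      rcases h with h | h <;> exact St_uniq (St_lA _ (St_uniq h (by decide))) (by decide)
    | h3 => exact absurd hcd (by decide)
    | h4 => rw [TT_lB] at h; exact St_uniq (St_lA _ (St_uniq h (by decide))) (by decide)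

def ll (c : LL) : F2 := if c = lb ∨ c = lA then ga⁻¹ else 1
def zz (c : LL) : F2 := (ll (linv c))⁻¹

theorem TT_base : ∀ d : LL, TT d (mL (mk [d]) * zz d) := by
  unfold TT St
  decide

theorem TT_St (c : LL) (y : F2) (h : TT c y) : St c (ll c * y) := by
  induction c using LL_cases with
  | h1 => rw [TT_la] at h; simpa [ll] using h.1
  | h2 =>
    rw [TT_lA] at h
    simp only [ll]
    rcases h with h | h <;> exact (St_lA _ (St_uniq h (by decide)))
  | h3 => rw [TT_lb] at h; simpa [ll] using h
  | h4 => rw [TT_lB] at h; simpa [ll] using h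

theorem TT_list (l : List LL) (c d : LL) (h : FreeGroup.IsReduced (c :: l))
    (hd : (c :: l).getLast? = some d) : TT c (mL (mk (c :: l)) * zz d) := by
  induction l generalizing c with
  | nil =>
    simp only [List.getLast?_singleton, Option.some.injEq] at hd
    subst hd
    exact TT_base c
  | cons e l ih =>
    rw [FreeGroup.isReduced_cons_cons] at h
    rw [List.getLast?_cons_cons] at hd
    have := ih e h.2 hd
    rw [← List.singleton_append, ← mul_mk, _root_.map_mul, mul_assoc]
    exact TT_step _ _ _ this h.1

def SE (c d : LL) (x : F2) : Prop := x.toWord.head? = some c ∧ x.toWord.getLast? = some d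

instance (c d : LL) (x : F2) : Decidable (SE c d x) := by unfold SE; infer_instance

theorem SE_inv {c d : LL} {x : F2} (h : SE c d x) : SE (linv d) (linv c) x⁻¹ := by
  obtain ⟨h1, h2⟩ := h
  unfold SE
  rw [toWord_inv, invRev]
  simp [h1, h2, linv]

theorem SE_head {c d : LL} {x : F2} (h : SE c d x) : St c (ll c * mL x * zz d) := by
  obtain ⟨h1, h2⟩ := h
  have hr : FreeGroup.IsReduced x.toWord := isReduced_toWord
  have hx := mk_toWord (x := x)
  rw [mul_assoc]
  apply TT_St
  cases hw : x.toWord with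
  | nil => simp [hw] at h1
  | cons e l =>
    rw [hw] at h1 h2 hr hx
    simp only [List.head?_cons, Option.some.injEq] at h1
    subst h1
    rw [← hx]
    exact TT_list l e d hr h2

theorem linv_linv (c : LL) : linv (linv c) = c := by simp [linv]

theorem SE_L {c d : LL} {x : F2} (h : SE c d x) : SE c d (ll c * mL x * zz d) := by
  refine ⟨SE_head h, ?_⟩
  have h2 := SE_head (SE_inv h)
  have e : ll (linv d) * mL x⁻¹ * zz (linv c) = (ll c * mL x * zz d)⁻¹ := by
    simp only [zz, linv_linv, _root_.map_inv]; group
  rw [e] at h2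
  unfold St at h2
  rw [toWord_inv, invRev] at h2
  simp only [List.head?_reverse, List.getLast?_map, Option.map_eq_some_iff] at h2
  obtain ⟨a, h3, h4⟩ := h2
  rw [h3]
  congr 1
  have := congrArg linv h4
  rw [linv_linv] at this
  simpa [linv] using this

theorem SE_mul {c d e f : LL} {x y : F2} (hx : SE c d x) (hy : SE e f y) (hde : Cmp d e) :
    SE c f (x * y) ∧ (x * y).toWord = x.toWord ++ y.toWord := by
  have hr : FreeGroup.IsReduced (x.toWord ++ y.toWord) := by
    unfold FreeGroup.IsReduced
    rw [List.isChain_append]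
    refine ⟨isReduced_toWord, isReduced_toWord, ?_⟩
    intro u hu v hv
    rw [hx.2] at hu
    rw [hy.1] at hv
    simp only [Option.mem_def, Option.some.injEq] at hu hv
    subst hu; subst hv
    exact hde
  have : (x * y).toWord = x.toWord ++ y.toWord := by
    rw [toWord_mul]; exact hr.reduce_eq
  refine ⟨?_, this⟩
  unfold SE
  rw [this]
  simp [List.head?_append, List.getLast?_append, hx.1, hy.2]

theorem SE_E {c d : LL} {x : F2} (h : SE c d x) : SE (elet c) (elet d) (mE x) := by
  have hw : (mE x).toWord = x.toWord.map elet := by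
    conv_lhs => rw [← mk_toWord (x := x), mE_mk, toWord_mk]
    apply FreeGroup.IsReduced.reduce_eq
    unfold FreeGroup.IsReduced
    rw [List.isChain_map]
    have : FreeGroup.IsReduced x.toWord := isReduced_toWord
    refine List.IsChain.imp ?_ this
    decide
  unfold SE
  rw [hw]
  simp [h.1, h.2]

theorem SE_D {c d : LL} {x : F2} (h : SE c d x) : SE (dlet c) (dlet d) (mD x) := by
  have hw : (mD x).toWord = x.toWord.map dlet := by
    conv_lhs => rw [← mk_toWord (x := x), mD_mk, toWord_mk]
    apply FreeGroup.IsReduced.reduce_eq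
    unfold FreeGroup.IsReduced
    rw [List.isChain_map]
    have : FreeGroup.IsReduced x.toWord := isReduced_toWord
    refine List.IsChain.imp ?_ this
    decide
  unfold SE
  rw [hw]
  simp [h.1, h.2]

theorem mR_eq (v : F2) : mR v = mE (mL (mE v)) := by rw [mL_E, mEE]

theorem SE_R {c d : LL} {x : F2} (h : SE c d x) :
    SE c d (mE (ll (elet c)) * mR x * mE (zz (elet d))) := by
  have := SE_E (SE_L (SE_E h))
  rw [_root_.map_mul, _root_.map_mul, ← mR_eq] at this
  have e : ∀ c, elet (elet c) = c := by decide
  rwa [e, e] at this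

def Obs (v : F2) : Prop :=
  ∃ (h S1 S2 : F2) (s s' t t' : LL), ((s = la ∧ s' = lb) ∨ (s = lb ∧ s' = la)) ∧
    ((t = lA ∧ t' = lB) ∨ (t = lB ∧ t' = lA)) ∧ SE s t S1 ∧ SE t' s' S2 ∧ v = h * (S1 * S2) * h⁻¹

theorem Obs_L (v : F2) (h : Obs v) : Obs (mL v) := by
  obtain ⟨h, S1, S2, s, s', t, t', hs, ht, h1, h2, rfl⟩ := h
  refine ⟨mL h * (ll s)⁻¹, _, _, s, s', t, t', hs, ht, SE_L h1, SE_L h2, ?_⟩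
  have e1 : zz t * ll t' = 1 := by
    rcases ht with ⟨rfl, rfl⟩ | ⟨rfl, rfl⟩ <;> decide
  have e2 : zz s' * ll s = 1 := by
    rcases hs with ⟨rfl, rfl⟩ | ⟨rfl, rfl⟩ <;> decide
  have e3 : zz s' = (ll s)⁻¹ := eq_inv_of_mul_eq_one_left e2
  have e4 : ll t' = (zz t)⁻¹ := eq_inv_of_mul_eq_one_right e1
  simp only [_root_.map_mul, _root_.map_inv, e3, e4]
  group

theorem Obs_E (v : F2) (h : Obs v) : Obs (mE v) := by
  obtain ⟨h, S1, S2, s, s', t, t', hs, ht, h1, h2, rfl⟩ := h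
  refine ⟨mE h, _, _, _, _, _, _, ?_, ?_, SE_E h1, SE_E h2, by simp only [_root_.map_mul, _root_.map_inv]⟩
  · rcases hs with ⟨rfl, rfl⟩ | ⟨rfl, rfl⟩ <;> decide
  · rcases ht with ⟨rfl, rfl⟩ | ⟨rfl, rfl⟩ <;> decide

theorem Obs_R (v : F2) (h : Obs v) : Obs (mR v) := by
  rw [mR_eq]; exact Obs_E _ (Obs_L _ (Obs_E _ h))

theorem pow_count {c d : LL} {y : F2} (h : SE c d y) (hc : Cmp d c) (x : LL) (hx : x ∈ y.toWord)
    (n : ℕ) : SE c d (y ^ (n + 1)) ∧ n + 1 ≤ (y ^ (n + 1)).toWord.count x := by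
  have h1 : 1 ≤ y.toWord.count x := List.count_pos_iff.2 hx
  induction n with
  | zero => simpa using ⟨h, hx⟩
  | succ n ih =>
    rw [pow_succ]
    have := SE_mul ih.1 h hc
    refine ⟨this.1, ?_⟩
    rw [this.2, List.count_append]
    omega

theorem NB2 {c1 d1 c2 d2 : LL} {y1 y2 : F2} (h1 : SE c1 d1 y1) (h2 : SE c2 d2 y2)
    (k1 : Cmp d1 c2) (k2 : Cmp d2 c1) (hall : ∀ c, c = c1 ∨ c = d1 ∨ c = c2 ∨ c = d2) (h : F2) :
    ¬ Bad (h * (y1 * y2) * h⁻¹) := by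
  rintro ⟨u1, u2, g, l, hl, e⟩
  obtain ⟨c, hc1, hc2⟩ : ∃ c : LL, c ≠ u1 ∧ c ≠ u2 := by
    revert u1 u2
    intro u1 u2 _
    clear * -
    revert u1 u2
    decide
  obtain ⟨hs, hw⟩ := SE_mul h1 h2 k1
  have hmem : c ∈ (y1 * y2).toWord := by
    rw [hw, List.mem_append]
    rcases hall c with r | r | r | r
    · exact .inl (List.mem_of_mem_head? (by rw [r]; exact h1.1))
    · exact .inl (List.mem_of_getLast? (by rw [r]; exact h1.2))
    · exact .inr (List.mem_of_mem_head? (by rw [r]; exact h2.1))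
    · exact .inr (List.mem_of_getLast? (by rw [r]; exact h2.2))
  set q := h⁻¹ * g with hq
  have e2 : y1 * y2 = q * mk l * q⁻¹ := by
    have : y1 * y2 = h⁻¹ * (h * (y1 * y2) * h⁻¹) * h := by group
    rw [this, e, hq]; group
  set N := q.toWord.length + q⁻¹.toWord.length with hN
  have hp := (pow_count hs k2 c hmem N).2
  have e3 : (y1 * y2) ^ (N + 1) = q * (mk l) ^ (N + 1) * q⁻¹ := by
    rw [e2, conj_pow]
  have hz : ∀ n : ℕ, ((mk l : F2) ^ n).toWord.count c = 0 := by
    intro n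
    rw [List.count_eq_zero, pow_mk, toWord_mk]
    intro hm
    have := (Red.sublist reduce.red).subset hm
    rw [List.mem_flatten] at this
    obtain ⟨l', hl', hm'⟩ := this
    rw [List.eq_of_mem_replicate hl'] at hm'
    rcases hl c hm' with r | r
    · exact hc1 r
    · exact hc2 r
  rw [e3] at hp
  have s1 := (toWord_mul_sublist (q * mk l ^ (N + 1)) q⁻¹).count_le c
  have s2 := (toWord_mul_sublist q (mk l ^ (N + 1))).count_le c
  rw [List.count_append] at s1 s2
  rw [hz] at s2
  have s3 := List.count_le_length (a := c) (l := q.toWord)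
  have s4 := List.count_le_length (a := c) (l := q⁻¹.toWord)
  omega

theorem Obs_notBad (v : F2) (h : Obs v) : ¬ Bad v := by
  obtain ⟨h, S1, S2, s, s', t, t', hs, ht, h1, h2, rfl⟩ := h
  apply NB2 h1 h2
  · rcases ht with ⟨rfl, rfl⟩ | ⟨rfl, rfl⟩ <;> decide
  · rcases hs with ⟨rfl, rfl⟩ | ⟨rfl, rfl⟩ <;> decide
  · rcases hs with ⟨rfl, rfl⟩ | ⟨rfl, rfl⟩ <;> rcases ht with ⟨rfl, rfl⟩ | ⟨rfl, rfl⟩ <;> decide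

theorem SE_a : SE la la ga := by decide
theorem SE_b : SE lb lb gb := by decide
theorem SE_A : SE lA lA ga⁻¹ := by decide
theorem SE_B : SE lB lB gb⁻¹ := by decide

theorem SE_m {c d e f : LL} {x y : F2} (hx : SE c d x) (hy : SE e f y)
    (hde : Cmp d e := by decide) : SE c f (x * y) := (SE_mul hx hy hde).1

theorem SE_apow (k : ℤ) (hk : 1 ≤ k) : SE la la (ga ^ k) := by
  obtain ⟨n, rfl⟩ : ∃ n : ℕ, k = ((n + 1 : ℕ) : ℤ) := ⟨(k - 1).toNat, by omega⟩
  rw [zpow_natCast]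
  exact (pow_count SE_a (by decide) la (by decide) n).1

theorem SE_Apow (k : ℤ) (hk : k ≤ -1) : SE lA lA (ga ^ k) := by
  have := SE_inv (SE_apow (-k) (by omega))
  simpa [linv] using this

def PP (l : List ℤ) : F2 := (l.map (fun k : ℤ => gb⁻¹ * ga ^ k)).prod

theorem PP_append (l l' : List ℤ) : PP (l ++ l') = PP l * PP l' := by simp [PP]
theorem PP_cons (k : ℤ) (l : List ℤ) : PP (k :: l) = gb⁻¹ * ga ^ k * PP l := by simp [PP]

theorem SE_PP (l : List ℤ) : SE lB lB (PP l * gb⁻¹) := by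
  induction l with
  | nil => decide
  | cons k l ih =>
    rw [PP_cons, mul_assoc]
    rcases lt_trichotomy k 0 with h | h | h
    · exact SE_m (SE_m SE_B (SE_Apow k (by omega))) ih
    · subst h
      simpa using SE_m SE_B ih
    · exact SE_m (SE_m SE_B (SE_apow k (by omega))) ih

def GG (l : List ℤ) (q : ℤ) : F2 := PP l * (gb⁻¹ * ga * gb * ga ^ (-q) * gb * ga)

theorem mL_PP (l : List ℤ) : mL (PP l) = PP (l.map (fun k => k - 1)) := by
  induction l with
  | nil => exact _root_.map_one _
  | cons k l ih =>
    rw [List.map_cons, PP_cons, PP_cons, _root_.map_mul, ih]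
    simp only [mL, _root_.map_mul, _root_.map_inv, map_zpow, mk2_a, mk2_b]
    congr 1
    rw [zpow_sub_one, (Commute.refl ga).zpow_left k |>.inv_right.eq]
    group

theorem mL_GG (l : List ℤ) (q : ℤ) : mL (GG l q) = GG (l.map (fun k => k - 1)) (q - 1) := by
  rw [GG, _root_.map_mul, mL_PP, GG]
  congr 1
  simp only [mL, _root_.map_mul, _root_.map_inv, map_zpow, mk2_a, mk2_b]
  group

theorem Obs_i (l1 l2 : List ℤ) (k0 q : ℤ) (hk : k0 ≤ -1) (hq : 1 ≤ q) :
    Obs (GG (l1 ++ k0 :: l2) q) := by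
  refine ⟨ga⁻¹, ga * (PP l1 * gb⁻¹), ga ^ k0 * (PP l2 * gb⁻¹) * ga * gb * ga ^ (-q) * gb,
    la, lb, lB, lA, by decide, by decide, ?_, ?_, ?_⟩
  · exact SE_m SE_a (SE_PP l1)
  · exact SE_m (SE_m (SE_m (SE_m (SE_m (SE_Apow k0 hk) (SE_PP l2)) SE_a) SE_b)
      (SE_Apow (-q) (by omega))) SE_b
  · rw [GG, PP_append, PP_cons]; group

theorem Obs_Rstate (l : List ℤ) (q : ℤ) (hq : 2 ≤ q) : Obs (mR (GG l q)) := by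
  have h1 : SE la lA (ga * (PP l * gb⁻¹) * ga * gb * ga⁻¹) :=
    SE_m (SE_m (SE_m (SE_m SE_a (SE_PP l)) SE_a) SE_b) SE_A
  have h2 : SE lA lb (ga ^ (-(q - 1)) * gb) := SE_m (SE_Apow _ (by omega)) SE_b
  have h3 := SE_R h1
  have h4 := SE_R h2
  have e1 : mE (ll (elet la)) = gb⁻¹ := by decide
  have e2 : mE (zz (elet lA)) = gb := by decide
  have e3 : mE (ll (elet lA)) = 1 := by decide
  have e4 : mE (zz (elet lb)) = gb := by decide
  rw [e1, e2] at h3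
  rw [e3, e4, one_mul] at h4
  refine ⟨(mR ga)⁻¹ * gb, _, _, la, lb, lB, lA, by decide, by decide, SE_m h3 SE_B, h4, ?_⟩
  have e : GG l q = ga⁻¹ * ((ga * (PP l * gb⁻¹) * ga * gb * ga⁻¹) * (ga ^ (-(q - 1)) * gb)) * ga := by
    rw [GG]; group
  rw [e, _root_.map_mul, _root_.map_mul, _root_.map_inv, _root_.map_mul]
  group

theorem State_notBad (l : List ℤ) (q : ℤ) (hq : 1 ≤ q) : ¬ Bad (GG l q) := by
  have h1 : SE lB lb ((PP l * gb⁻¹) * ga * gb) := SE_m (SE_m (SE_PP l) SE_a) SE_b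
  have h2 : SE lA la (ga ^ (-q) * gb * ga) := SE_m (SE_m (SE_Apow _ (by omega)) SE_b) SE_a
  have := NB2 h1 h2 (by decide) (by decide) (by decide) 1
  convert this using 1
  rw [GG]; group

theorem Obs_D (l : List ℤ) (q : ℤ) (hq : 1 ≤ q) : Obs (mD (GG l q)) := by
  have h1 : SE lB lb ((PP l * gb⁻¹) * ga * gb) := SE_m (SE_m (SE_PP l) SE_a) SE_b
  have h2 : SE lA la (ga ^ (-q) * gb * ga) := SE_m (SE_m (SE_Apow _ (by omega)) SE_b) SE_a
  refine ⟨1, _, _, lb, la, lB, lA, by decide, by decide, SE_D h1, SE_D h2, ?_⟩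
  rw [← _root_.map_mul, one_mul, inv_one, mul_one, GG]
  congr 1
  group

def State1 (v : F2) : Prop :=
  ∃ (l1 l2 : List ℤ) (k0 q : ℤ), 0 ≤ k0 ∧ k0 + 2 ≤ q ∧ v = GG (l1 ++ k0 :: l2) q

theorem BB_main (w : F2) (hw : State1 w) (v : F2) (h : BB w v) : Obs v ∨ State1 v := by
  induction h with
  | base => exact .inr hw
  | based =>
    obtain ⟨l1, l2, k0, q, h0, h2, rfl⟩ := hw
    exact .inl (Obs_D _ _ (by omega))
  | L v _ ih =>
    rcases ih with ih | ⟨l1, l2, k0, q, h0, h2, rfl⟩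
    · exact .inl (Obs_L _ ih)
    · rw [mL_GG, List.map_append, List.map_cons]
      by_cases hk : k0 = 0
      · exact .inl (Obs_i _ _ _ _ (by omega) (by omega))
      · exact .inr ⟨_, _, _, _, by omega, by omega, rfl⟩
  | R v _ ih =>
    rcases ih with ih | ⟨l1, l2, k0, q, h0, h2, rfl⟩
    · exact .inl (Obs_R _ ih)
    · exact .inl (Obs_Rstate _ _ (by omega))

theorem main (w : F2) (hw : State1 w) : ¬ PotPos2 w := by
  apply reduction
  intro v hv
  rcases BB_main w hw v hv with h | ⟨l1, l2, k0, q, h0, h2, rfl⟩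
  · exact Obs_notBad _ h
  · exact State_notBad _ _ (by omega)

end Pump

theorem pumped_word_not_potPos (k m : ℕ) (hk : 1 ≤ k) (hm : 1 ≤ m)
    (n : Fin k → ℕ) (hn : ∀ i, 1 ≤ n i)
    (w : F2)
    (hw : w = (List.ofFn fun i : Fin k => gb⁻¹ * ga ^ n i).prod *
      (gb⁻¹ * ga * gb * (ga ^ m)⁻¹ * gb * ga))
    (hlt : ∃ i : Fin k, n i < m - 1) :
    ¬ PotPos2 w := by
  obtain ⟨i, hi⟩ := hlt
  have hmem : ((n i : ℕ) : ℤ) ∈ List.ofFn (fun i => ((n i : ℕ) : ℤ)) := by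
    rw [List.mem_ofFn]; exact ⟨i, rfl⟩
  obtain ⟨l1, l2, e⟩ := List.append_of_mem hmem
  apply Pump.main
  refine ⟨l1, l2, (n i : ℤ), (m : ℤ), by omega, by omega, ?_⟩
  rw [← e, hw, Pump.GG, Pump.PP, List.map_ofFn]
  simp only [Function.comp_def, zpow_natCast, zpow_neg]
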